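/- arXiv:1710.08943 — 3 statements merged into one kernel-verified Lean document; each statement's English description precedes it below -/
import Mathlib

section
/- For all integers n ≥ m ≥ 1, the set G_m = {μ ∈ A_n : G(μ) ≤ m} of n-dimensional algebra structures of generation type at most m is a Zariski-closed subset of A_n. -/
open scoped BigOperators

noncomputable section

/-- The space of `n`-dimensional (nonassociative) algebra structures on `kⁿ`:
bilinear maps `kⁿ × kⁿ → kⁿ`. -/
abbrev AlgStr (k : Type*) [Field k] (n : ℕ) : Type _ :=
  (Fin n → k) →ₗ[k] (Fin n → k) →ₗ[k] (Fin n → k)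

variable {k : Type*} [Field k]

/-- The algebra structure with prescribed structure constants `c`:
`μ(x, y) m = ∑ i, ∑ j, x i * y j * c i j m`. -/
def ofConst {n : ℕ} (c : Fin n → Fin n → Fin n → k) : AlgStr k n :=
  ∑ i, ∑ j,
    ((LinearMap.mul k k).compl₁₂ (LinearMap.proj i) (LinearMap.proj j)).compr₂
      (LinearMap.toSpanSingleton k (Fin n → k) (c i j))

/-- The structure constants of an algebra structure in the standard basis. -/
def structConst {n : ℕ} (μ : AlgStr k n) : Fin n × Fin n × Fin n → k :=
  fun t => μ (Pi.single t.1 1) (Pi.single t.2.1 1) t.2.2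

/-- A subset of `AlgStr k n` is Zariski closed if it is the common zero locus of a
family of polynomials in the structure constants. -/
def IsZariskiClosed {n : ℕ} (S : Set (AlgStr k n)) : Prop :=
  ∃ P : Set (MvPolynomial (Fin n × Fin n × Fin n) k),
    ∀ μ : AlgStr k n, μ ∈ S ↔ ∀ p ∈ P, MvPolynomial.eval (structConst μ) p = 0

/-- The action of `GL(V)` on algebra structures: `(g • μ)(x,y) = g (μ (g⁻¹ x) (g⁻¹ y))`. -/
def transport {n : ℕ} (g : (Fin n → k) ≃ₗ[k] (Fin n → k)) (μ : AlgStr k n) :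
    AlgStr k n :=
  ((μ.comp g.symm.toLinearMap).compl₂ g.symm.toLinearMap).compr₂ g.toLinearMap

/-- The `GL(V)`-orbit of an algebra structure; two structures represent isomorphic
algebras iff they lie in the same orbit. -/
def orbit {n : ℕ} (μ : AlgStr k n) : Set (AlgStr k n) :=
  {χ | ∃ g : (Fin n → k) ≃ₗ[k] (Fin n → k), transport g μ = χ}

/-- The Zariski closure of a set of algebra structures. -/
def zclosure {n : ℕ} (S : Set (AlgStr k n)) : Set (AlgStr k n) :=
  {χ | ∀ T : Set (AlgStr k n), IsZariskiClosed T → S ⊆ T → χ ∈ T}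

/-- `μ` degenerates to `χ` if `χ` lies in the Zariski closure of the orbit of `μ`. -/
def degenerates {n : ℕ} (μ χ : AlgStr k n) : Prop :=
  χ ∈ zclosure (orbit μ)

/-- A proper degeneration: additionally `χ` is not isomorphic to `μ`. -/
def properlyDegenerates {n : ℕ} (μ χ : AlgStr k n) : Prop :=
  degenerates μ χ ∧ χ ∉ orbit μ

/-- There is a chain of `m` proper degenerations starting at `μ`. -/
def hasChain {n : ℕ} (μ : AlgStr k n) (m : ℕ) : Prop :=
  ∃ c : ℕ → AlgStr k n, c m = μ ∧ ∀ i < m, properlyDegenerates (c (i + 1)) (c i)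

/-- The level of `μ` is `m`: there is a chain of `m` proper degenerations starting
at `μ` but no chain of `m+1`. -/
def levelIs {n : ℕ} (μ : AlgStr k n) (m : ℕ) : Prop :=
  hasChain μ m ∧ ¬ hasChain μ (m + 1)

/-- The subalgebra generated by a set `s`. -/
def subalgGen {n : ℕ} (μ : AlgStr k n) (s : Set (Fin n → k)) :
    Submodule k (Fin n → k) :=
  sInf {W | s ⊆ W ∧ ∀ x ∈ W, ∀ y ∈ W, μ x y ∈ W}

/-- The generation type of `μ` is `m`: `m` is the maximal dimension of a
one-generated subalgebra. -/
def genType {n : ℕ} (μ : AlgStr k n) (m : ℕ) : Prop :=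
  IsGreatest {d : ℕ | ∃ a : Fin n → k, Module.finrank k ↥(subalgGen μ {a}) = d} m

/-- A standard `1`-generated algebra: it admits a grading `A = ⊕_{i ≥ 1} A_i` with
`dim A_1 = 1`, `A_i A_j ⊆ A_{i+j}`, generated by `A_1` as an algebra. -/
def StandardOneGenerated {m : ℕ} (μ : AlgStr k m) : Prop :=
  ∃ A : ℕ → Submodule k (Fin m → k),
    A 0 = ⊥ ∧ DirectSum.IsInternal A ∧ Module.finrank k ↥(A 1) = 1 ∧
    (∀ i j : ℕ, ∀ x ∈ A i, ∀ y ∈ A j, μ x y ∈ A (i + j)) ∧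
    subalgGen μ ((A 1 : Submodule k (Fin m → k)) : Set (Fin m → k)) = ⊤

/-- Extension by zero of coordinates, `kᵐ → kⁿ`. -/
def inclMap (k : Type*) [Field k] {m n : ℕ} (h : m ≤ n) :
    (Fin m → k) →ₗ[k] (Fin n → k) where
  toFun x i := if hi : (i : ℕ) < m then x ⟨i, hi⟩ else 0
  map_add' x y := by funext i; by_cases hi : (i : ℕ) < m <;> simp [hi]
  map_smul' a x := by funext i; by_cases hi : (i : ℕ) < m <;> simp [hi]

/-- The `n`-dimensional algebra `B ⊕ k^{n-m}` obtained from an `m`-dimensional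
algebra `B` by adjoining a complement with all products zero. -/
def extendZero {m n : ℕ} (h : m ≤ n) (B : AlgStr k m) : AlgStr k n :=
  ((B.comp (LinearMap.funLeft k k (Fin.castLE h))).compl₂
      (LinearMap.funLeft k k (Fin.castLE h))).compr₂ (inclMap k h)

/-- The `i`-th standard basis vector (as a plain function, `0` if `i ≥ n`). -/
def unitVec {k : Type*} [Field k] (n i : ℕ) : Fin n → k :=
  fun j => if (j : ℕ) = i then 1 else 0

/-- Projection onto the coordinate `0` part. -/
def proj0 (k : Type*) [Field k] (n : ℕ) : (Fin n → k) →ₗ[k] (Fin n → k) :=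
  LinearMap.pi fun i => if (i : ℕ) = 0 then LinearMap.proj i else 0

/-- Projection onto the coordinates `≥ 1` part. -/
def projPos (k : Type*) [Field k] (n : ℕ) : (Fin n → k) →ₗ[k] (Fin n → k) :=
  LinearMap.pi fun i => if (i : ℕ) = 0 then 0 else LinearMap.proj i

/-- The Inönü–Wigner contraction of `μ` with respect to the `1`-dimensional
subalgebra spanned by the first basis vector (the remaining coordinates form the
square-zero ideal part). -/
def IWcontract0 {n : ℕ} (μ : AlgStr k n) : AlgStr k n :=
  ((μ.comp (projPos k n)).compl₂ (proj0 k n)).compr₂ (projPos k n) +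
    ((μ.comp (proj0 k n)).compl₂ (projPos k n)).compr₂ (projPos k n) +
    (μ.comp (proj0 k n)).compl₂ (proj0 k n)

/-- The annihilator of an algebra structure. -/
def annihilator {n : ℕ} (μ : AlgStr k n) : Submodule k (Fin n → k) where
  carrier := {a | ∀ b, μ a b = 0 ∧ μ b a = 0}
  add_mem' := by
    intro a b ha hb
    intro c
    constructor
    · rw [map_add, LinearMap.add_apply, (ha c).1, (hb c).1, add_zero]
    · rw [map_add, (ha c).2, (hb c).2, add_zero]
  zero_mem' := by
    intro b
    constructor
    · rw [map_zero, LinearMap.zero_apply]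
    · rw [map_zero]
  smul_mem' := by
    intro t a ha b
    constructor
    · rw [map_smul, LinearMap.smul_apply, (ha b).1, smul_zero]
    · rw [map_smul, (ha b).2, smul_zero]

/-- `μ` has a square-zero (two-sided) ideal of codimension `1`. -/
def hasSqZeroIdealCodim1 {n : ℕ} (μ : AlgStr k n) : Prop :=
  ∃ I : Submodule k (Fin n → k), Module.finrank k ↥I = n - 1 ∧
    (∀ x ∈ I, ∀ y : Fin n → k, μ x y ∈ I ∧ μ y x ∈ I) ∧
    ∀ x ∈ I, ∀ y ∈ I, μ x y = 0

/-- `a` (viewed as the sequence of parts `a 0 ≥ a 1 ≥ …`) is a partition of `N`. -/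
def IsPartitionOf (a : ℕ → ℕ) (N : ℕ) : Prop :=
  (∀ i j : ℕ, i ≤ j → a j ≤ a i) ∧
    ∃ l : ℕ, (∀ i, l ≤ i → a i = 0) ∧ ∑ i ∈ Finset.range l, a i = N

/-- The dominance order on partitions: `a ⪰ b`. -/
def Dominates (a b : ℕ → ℕ) : Prop :=
  ∀ m : ℕ, ∑ i ∈ Finset.range m, b i ≤ ∑ i ∈ Finset.range m, a i

/-- `a` is the Jordan type of the matrix `M` at the eigenvalue `lam`:
`a` is a partition of the generalized eigenspace dimension, and the parts of `a`
are the sizes of the Jordan blocks of `M` with eigenvalue `lam`, expressed via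
the ranks of powers of `M - lam • 1`. -/
def IsJordanTypeAt {N : ℕ} (M : Matrix (Fin N) (Fin N) k) (lam : k) (a : ℕ → ℕ) :
    Prop :=
  IsPartitionOf a (N - ((M - lam • (1 : Matrix (Fin N) (Fin N) k)) ^ N).rank) ∧
    ∀ p : ℕ, ((M - lam • (1 : Matrix (Fin N) (Fin N) k)) ^ p).rank =
      N - ∑ i ∈ Finset.range N, min (a i) p

/-- The full specter of `M` is `{(lam i, a i)}`: the `lam i` are pairwise distinct,
each `a i` is the (nonempty) Jordan type of `M` at `lam i`, and every eigenvalue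
of `M` occurs among the `lam i`. -/
def IsFullSpecter {N : ℕ} (M : Matrix (Fin N) (Fin N) k) {l : ℕ}
    (lam : Fin l → k) (a : Fin l → ℕ → ℕ) : Prop :=
  Function.Injective lam ∧
    (∀ i, IsJordanTypeAt M (lam i) (a i) ∧ a i 0 ≠ 0) ∧
    ∀ c : k, (∃ v : Fin N → k, v ≠ 0 ∧ M.mulVec v = c • v) → ∃ i, lam i = c

/-- There is a chain of `len` strict dominance steps of partitions of `N`
starting (on top) at `a`. -/
def partChain (a : ℕ → ℕ) (N len : ℕ) : Prop :=
  ∃ c : ℕ → ℕ → ℕ, (∀ i ≤ len, IsPartitionOf (c i) N) ∧ c len = a ∧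
    ∀ i < len, Dominates (c (i + 1)) (c i) ∧ c (i + 1) ≠ c i

/-- The structure `T_α^M ∈ A_{m+1}`. -/
def Tstr {m : ℕ} (α : k) (M : Matrix (Fin m) (Fin m) k) : AlgStr k (m + 1) :=
  ofConst fun i j mm =>
    if hi : i = 0 then
      if hj : j = 0 then (if mm = 0 then α else 0)
      else if hmm : mm = 0 then 0 else M (mm.pred hmm) (j.pred hj)
    else if hj : j = 0 then
      if hmm : mm = 0 then 0 else (if i = mm then α else 0) - M (mm.pred hmm) (i.pred hi)
    else 0

/-- The trivial singular extension `k^{n-2} ⋊_{(L₁,R₁,L₂,R₂)} χ` of the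
`2`-dimensional algebra `χ` given by the coefficients `c11, c12, c21, d12, d21, d22`
(with `χ(e₁,e₁) = c11·e₁ + e₂`, `χ(e₁,e₂) = c12·e₁ + d12·e₂`,
`χ(e₂,e₁) = c21·e₁ + d21·e₂`, `χ(e₂,e₂) = d22·e₂`). -/
def sdExt {m : ℕ} (c11 c12 c21 d12 d21 d22 : k)
    (L1 R1 L2 R2 : Matrix (Fin m) (Fin m) k) : AlgStr k (m + 2) :=
  ofConst fun i j mm =>
    if hi0 : (i : ℕ) = 0 then
      if hj0 : (j : ℕ) = 0 then
        if (mm : ℕ) = 0 then c11 else if (mm : ℕ) = 1 then 1 else 0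
      else if hj1 : (j : ℕ) = 1 then
        if (mm : ℕ) = 0 then c12 else if (mm : ℕ) = 1 then d12 else 0
      else if hmm : (mm : ℕ) < 2 then 0
      else L1 ⟨(mm : ℕ) - 2, by have := mm.isLt; omega⟩
             ⟨(j : ℕ) - 2, by have := j.isLt; omega⟩
    else if hi1 : (i : ℕ) = 1 then
      if hj0 : (j : ℕ) = 0 then
        if (mm : ℕ) = 0 then c21 else if (mm : ℕ) = 1 then d21 else 0
      else if hj1 : (j : ℕ) = 1 then
        if (mm : ℕ) = 1 then d22 else 0
      else if hmm : (mm : ℕ) < 2 then 0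
      else L2 ⟨(mm : ℕ) - 2, by have := mm.isLt; omega⟩
             ⟨(j : ℕ) - 2, by have := j.isLt; omega⟩
    else
      if hj0 : (j : ℕ) = 0 then
        if hmm : (mm : ℕ) < 2 then 0
        else R1 ⟨(mm : ℕ) - 2, by have := mm.isLt; omega⟩
               ⟨(i : ℕ) - 2, by have := i.isLt; omega⟩
      else if hj1 : (j : ℕ) = 1 then
        if hmm : (mm : ℕ) < 2 then 0
        else R2 ⟨(mm : ℕ) - 2, by have := mm.isLt; omega⟩
               ⟨(i : ℕ) - 2, by have := i.isLt; omega⟩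
      else 0

/-! Concrete algebra structures, given by multiplication tables on the standard
basis `e₁, …, eₙ` (0-indexed as `0, …, n-1`); all unspecified products are zero. -/

/-- `A₃ ⊕ k^{n-2}`: `e₁e₁ = e₂`. -/
def A3str (n : ℕ) : AlgStr k n :=
  ofConst fun i j m => if (i : ℕ) = 0 ∧ (j : ℕ) = 0 ∧ (m : ℕ) = 1 then 1 else 0

/-- `n₃ ⊕ k^{n-3}`: `e₁e₂ = e₃`, `e₂e₁ = -e₃`. -/
def n3str (n : ℕ) : AlgStr k n :=
  ofConst fun i j m =>
    if (i : ℕ) = 0 ∧ (j : ℕ) = 1 ∧ (m : ℕ) = 2 then 1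
    else if (i : ℕ) = 1 ∧ (j : ℕ) = 0 ∧ (m : ℕ) = 2 then -1
    else 0

/-- `p⁻`: `e₁eᵢ = eᵢ`, `eᵢe₁ = -eᵢ` for `i ≥ 2`. -/
def pminusStr (n : ℕ) : AlgStr k n :=
  ofConst fun i j m =>
    if (i : ℕ) = 0 ∧ 1 ≤ (j : ℕ) ∧ m = j then 1
    else if 1 ≤ (i : ℕ) ∧ (j : ℕ) = 0 ∧ m = i then -1
    else 0

/-- `ν^α`: `e₁e₁ = e₁`, `e₁eᵢ = α eᵢ`, `eᵢe₁ = (1-α) eᵢ` for `i ≥ 2`. -/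
def nuStr (n : ℕ) (α : k) : AlgStr k n :=
  ofConst fun i j m =>
    if (i : ℕ) = 0 then
      if (j : ℕ) = 0 then (if (m : ℕ) = 0 then 1 else 0)
      else (if m = j then α else 0)
    else if (j : ℕ) = 0 then (if m = i then 1 - α else 0)
    else 0

/-- `k^{n-2} ⋊ E₄`: `e₁e₁ = e₁`, `e₁e₂ = e₁ + e₂`, `e₂e₂ = e₂`,
`e₁eᵢ = eᵢ`, `eᵢe₂ = eᵢ` for `i ≥ 3`.  (For `n = 2` this is `E₄`.) -/
def kE4str (n : ℕ) : AlgStr k n :=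
  ofConst fun i j m =>
    if (i : ℕ) = 0 ∧ (j : ℕ) = 0 then (if (m : ℕ) = 0 then 1 else 0)
    else if (i : ℕ) = 0 ∧ (j : ℕ) = 1 then (if (m : ℕ) = 0 ∨ (m : ℕ) = 1 then 1 else 0)
    else if (i : ℕ) = 1 ∧ (j : ℕ) = 1 then (if (m : ℕ) = 1 then 1 else 0)
    else if (i : ℕ) = 0 ∧ 2 ≤ (j : ℕ) then (if m = j then 1 else 0)
    else if 2 ≤ (i : ℕ) ∧ (j : ℕ) = 1 then (if m = i then 1 else 0)
    else 0

/-- `T₀^{2,(α,β)}`: `e₁e₂ = αe₂ + e₃`, `e₂e₁ = -αe₂ - e₃`,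
`e₁eᵢ = βeᵢ`, `eᵢe₁ = -βeᵢ` for `i ≥ 3`. -/
def T02str (n : ℕ) (α β : k) : AlgStr k n :=
  ofConst fun i j m =>
    if (i : ℕ) = 0 ∧ (j : ℕ) = 1 then
      (if (m : ℕ) = 1 then α else if (m : ℕ) = 2 then 1 else 0)
    else if (i : ℕ) = 1 ∧ (j : ℕ) = 0 then
      (if (m : ℕ) = 1 then -α else if (m : ℕ) = 2 then -1 else 0)
    else if (i : ℕ) = 0 ∧ 2 ≤ (j : ℕ) then (if m = j then β else 0)
    else if 2 ≤ (i : ℕ) ∧ (j : ℕ) = 0 then (if m = i then -β else 0)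
    else 0

/-- `T₁^{2,(α,β)}`: `e₁e₁ = e₁`, `e₁e₂ = αe₂ + e₃`, `e₂e₁ = (1-α)e₂ - e₃`,
`e₁eᵢ = βeᵢ`, `eᵢe₁ = (1-β)eᵢ` for `i ≥ 3`. -/
def T12str (n : ℕ) (α β : k) : AlgStr k n :=
  ofConst fun i j m =>
    if (i : ℕ) = 0 ∧ (j : ℕ) = 0 then (if (m : ℕ) = 0 then 1 else 0)
    else if (i : ℕ) = 0 ∧ (j : ℕ) = 1 then
      (if (m : ℕ) = 1 then α else if (m : ℕ) = 2 then 1 else 0)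
    else if (i : ℕ) = 1 ∧ (j : ℕ) = 0 then
      (if (m : ℕ) = 1 then 1 - α else if (m : ℕ) = 2 then -1 else 0)
    else if (i : ℕ) = 0 ∧ 2 ≤ (j : ℕ) then (if m = j then β else 0)
    else if 2 ≤ (i : ℕ) ∧ (j : ℕ) = 0 then (if m = i then 1 - β else 0)
    else 0

/-- `T₀³`: `e₁e₂ = e₃`, `e₂e₁ = -e₃`, `e₁e₃ = e₄`, `e₃e₁ = -e₄`. -/
def T03str (n : ℕ) : AlgStr k n :=
  ofConst fun i j m =>
    if (i : ℕ) = 0 ∧ (j : ℕ) = 1 ∧ (m : ℕ) = 2 then 1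
    else if (i : ℕ) = 1 ∧ (j : ℕ) = 0 ∧ (m : ℕ) = 2 then -1
    else if (i : ℕ) = 0 ∧ (j : ℕ) = 2 ∧ (m : ℕ) = 3 then 1
    else if (i : ℕ) = 2 ∧ (j : ℕ) = 0 ∧ (m : ℕ) = 3 then -1
    else 0

/-- `T₀^{2,2}`: `e₁e₂ = e₃`, `e₂e₁ = -e₃`, `e₁e₄ = e₅`, `e₄e₁ = -e₅`. -/
def T022str (n : ℕ) : AlgStr k n :=
  ofConst fun i j m =>
    if (i : ℕ) = 0 ∧ (j : ℕ) = 1 ∧ (m : ℕ) = 2 then 1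
    else if (i : ℕ) = 1 ∧ (j : ℕ) = 0 ∧ (m : ℕ) = 2 then -1
    else if (i : ℕ) = 0 ∧ (j : ℕ) = 3 ∧ (m : ℕ) = 4 then 1
    else if (i : ℕ) = 3 ∧ (j : ℕ) = 0 ∧ (m : ℕ) = 4 then -1
    else 0

/-- `η_l ⊕ k^{n-2l-1}`: `e_{2i-1}e_{2i} = e_{2l+1}`, `e_{2i}e_{2i-1} = -e_{2l+1}`
for `1 ≤ i ≤ l`. -/
def etaStr (n l : ℕ) : AlgStr k n :=
  ofConst fun i j m =>
    if (i : ℕ) % 2 = 0 ∧ (j : ℕ) = (i : ℕ) + 1 ∧ (i : ℕ) < 2 * l ∧ (m : ℕ) = 2 * l then 1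
    else if (j : ℕ) % 2 = 0 ∧ (i : ℕ) = (j : ℕ) + 1 ∧ (j : ℕ) < 2 * l ∧ (m : ℕ) = 2 * l then -1
    else 0

/-- `F^{α,β} ⊕ k^{n-3}`: `e₁e₁ = e₃`, `e₁e₂ = αe₃`, `e₂e₁ = βe₃`. -/
def FabStr (n : ℕ) (α β : k) : AlgStr k n :=
  ofConst fun i j m =>
    if (i : ℕ) = 0 ∧ (j : ℕ) = 0 ∧ (m : ℕ) = 2 then 1
    else if (i : ℕ) = 0 ∧ (j : ℕ) = 1 ∧ (m : ℕ) = 2 then α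
    else if (i : ℕ) = 1 ∧ (j : ℕ) = 0 ∧ (m : ℕ) = 2 then β
    else 0

/-- `k^{n-2} ⋊ A₃`: `e₁e₁ = e₂`, `e₁eᵢ = eᵢ`, `eᵢe₁ = -eᵢ` for `i ≥ 3`. -/
def kA3str (n : ℕ) : AlgStr k n :=
  ofConst fun i j m =>
    if (i : ℕ) = 0 ∧ (j : ℕ) = 0 ∧ (m : ℕ) = 1 then 1
    else if (i : ℕ) = 0 ∧ 2 ≤ (j : ℕ) then (if m = j then 1 else 0)
    else if 2 ≤ (i : ℕ) ∧ (j : ℕ) = 0 then (if m = i then -1 else 0)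
    else 0

/-- `k² ⋊_{α,β} A₃ ⊕ k^{n-4}`: `e₁e₁ = e₂`, `e₁e₃ = αe₄`, `e₃e₁ = βe₄`. -/
def k2A3str (n : ℕ) (α β : k) : AlgStr k n :=
  ofConst fun i j m =>
    if (i : ℕ) = 0 ∧ (j : ℕ) = 0 ∧ (m : ℕ) = 1 then 1
    else if (i : ℕ) = 0 ∧ (j : ℕ) = 2 ∧ (m : ℕ) = 3 then α
    else if (i : ℕ) = 2 ∧ (j : ℕ) = 0 ∧ (m : ℕ) = 3 then β
    else 0

/-- `k^{n-2} ⋊_α A₁^α`: `e₁e₁ = e₁ + e₂`, `e₁eᵢ = αeᵢ`, `eᵢe₁ = (1-α)eᵢ` for `i ≥ 2`. -/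
def kA1str (n : ℕ) (α : k) : AlgStr k n :=
  ofConst fun i j m =>
    if (i : ℕ) = 0 ∧ (j : ℕ) = 0 then (if (m : ℕ) = 0 ∨ (m : ℕ) = 1 then 1 else 0)
    else if (i : ℕ) = 0 then (if m = j then α else 0)
    else if (j : ℕ) = 0 then (if m = i then 1 - α else 0)
    else 0

/-- `k^{n-2} ⋊₁ A₂`: `e₁e₁ = e₂`, `e₁eᵢ = eᵢ`, `eᵢe₁ = -eᵢ` for `i ≥ 2`. -/
def kA2str (n : ℕ) : AlgStr k n :=
  ofConst fun i j m =>
    if (i : ℕ) = 0 ∧ (j : ℕ) = 0 then (if (m : ℕ) = 1 then 1 else 0)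
    else if (i : ℕ) = 0 then (if m = j then 1 else 0)
    else if (j : ℕ) = 0 then (if m = i then -1 else 0)
    else 0

/-- `k^{n-2} ⋊₀ᵗ B₂^α`: `e₁eᵢ = αeᵢ`, `eᵢe₁ = (1-α)eᵢ` for `i ≥ 2`. -/
def ktB2str (n : ℕ) (α : k) : AlgStr k n :=
  ofConst fun i j m =>
    if (i : ℕ) = 0 ∧ 1 ≤ (j : ℕ) then (if m = j then α else 0)
    else if 1 ≤ (i : ℕ) ∧ (j : ℕ) = 0 then (if m = i then 1 - α else 0)
    else 0

/-- `k^{n-2} ⋊₀ᵗ D₂^{α,β}`: `e₁e₁ = e₁`, `e₁eᵢ = αeᵢ`, `eᵢe₁ = βeᵢ` for `i ≥ 2`. -/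
def ktD2str (n : ℕ) (α β : k) : AlgStr k n :=
  ofConst fun i j m =>
    if (i : ℕ) = 0 ∧ (j : ℕ) = 0 then (if (m : ℕ) = 0 then 1 else 0)
    else if (i : ℕ) = 0 then (if m = j then α else 0)
    else if (j : ℕ) = 0 then (if m = i then β else 0)
    else 0


/-- The value of a nonassociative monomial in one variable at the element `a` of `(kⁿ, μ)`. -/
def evalWord {n : ℕ} (μ : AlgStr k n) (a : Fin n → k) : FreeMagma Unit → Fin n → k
  | .of _ => a
  | .mul x y => μ (evalWord μ a x) (evalWord μ a y)

/-- The coordinates of `evalWord μ a w` as polynomials in the structure constants of `μ`. -/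
def wordPoly {n : ℕ} (a : Fin n → k) :
    FreeMagma Unit → Fin n → MvPolynomial (Fin n × Fin n × Fin n) k
  | .of _ => fun l => MvPolynomial.C (a l)
  | .mul x y => fun l => ∑ i, ∑ j, wordPoly a x i * wordPoly a y j * MvPolynomial.X (i, j, l)

theorem apply_eq_sum_structConst {n : ℕ} (μ : AlgStr k n) (x y : Fin n → k) (l : Fin n) :
    μ x y l = ∑ i, ∑ j, x i * y j * structConst μ (i, j, l) := by
  have expand (z : Fin n → k) : z = ∑ i, z i • Pi.single i 1 := by
    simpa using ((Pi.basisFun k (Fin n)).sum_repr z).symm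
  conv_lhs => rw [expand x, expand y]
  simp only [map_sum, LinearMap.sum_apply, map_smul, LinearMap.smul_apply, Finset.sum_apply,
    Pi.smul_apply, smul_eq_mul, structConst]
  rw [Finset.sum_comm]
  refine Finset.sum_congr rfl fun j _ => ?_
  rw [Finset.mul_sum]
  exact Finset.sum_congr rfl fun i _ => by ring

theorem eval_wordPoly {n : ℕ} (μ : AlgStr k n) (a : Fin n → k) (w : FreeMagma Unit)
    (l : Fin n) :
    MvPolynomial.eval (structConst μ) (wordPoly a w l) = evalWord μ a w l := by
  induction w generalizing l with
  | ih1 _ => simp [wordPoly, evalWord]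
  | ih2 x y hx hy =>
    change MvPolynomial.eval _ (∑ i, ∑ j, _ * _ * _) = μ _ _ l
    simp [apply_eq_sum_structConst μ, hx, hy]

theorem subalgGen_singleton_eq_span {n : ℕ} (μ : AlgStr k n) (a : Fin n → k) :
    subalgGen μ {a} = Submodule.span k (Set.range (evalWord μ a)) := by
  apply le_antisymm
  · refine sInf_le ⟨?_, fun x hx y hy => ?_⟩
    · rintro _ rfl
      exact Submodule.subset_span ⟨.of (), rfl⟩
    · have h := Submodule.apply_mem_map₂ μ hx hy
      rw [Submodule.map₂_span_span] at h
      refine Submodule.span_mono ?_ h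
      rintro _ ⟨_, ⟨u, rfl⟩, _, ⟨v, rfl⟩, rfl⟩
      exact ⟨.mul u v, rfl⟩
  · refine le_sInf fun W hW => Submodule.span_le.2 ?_
    rintro _ ⟨w, rfl⟩
    induction w with
    | ih1 _ => exact hW.1 rfl
    | ih2 x y hx hy => exact hW.2 _ hx _ hy

theorem finrank_span_range_le_iff {ι V : Type*} [AddCommGroup V] [Module k V]
    [FiniteDimensional k V] (f : ι → V) (m : ℕ) :
    Module.finrank k (Submodule.span k (Set.range f)) ≤ m ↔
      ∀ w : Fin (m + 1) → ι, ¬ LinearIndependent k (f ∘ w) := by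
  constructor
  · intro h w hw
    have h1 := finrank_span_eq_card hw
    have h2 := Submodule.finrank_mono (R := k)
      (Submodule.span_mono (Set.range_comp_subset_range w f))
    rw [h1, Fintype.card_fin] at h2
    omega
  · contrapose!
    intro h
    obtain ⟨g, hg, -, hli⟩ := Submodule.exists_fun_fin_finrank_span_eq k (Set.range f)
    choose w hw using hg
    refine ⟨w ∘ Fin.castLE h, ?_⟩
    have : f ∘ w ∘ Fin.castLE h = g ∘ Fin.castLE h := by
      funext i; simp [hw]
    rw [this]
    exact hli.comp _ (Fin.castLE_injective h)

theorem linearIndependent_iff_exists_det_ne_zero {ι κ : Type*} [Fintype ι] [DecidableEq ι]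
    [Fintype κ] [DecidableEq κ] (v : ι → κ → k) :
    LinearIndependent k v ↔
      ∃ L : Matrix ι κ k, (Matrix.of fun i j => ∑ l, L i l * v j l).det ≠ 0 := by
  constructor
  · intro hv
    obtain ⟨g, hg⟩ := LinearMap.exists_leftInverse_of_injective _
      (LinearMap.ker_eq_bot.2 hv.fintypeLinearCombination_injective)
    refine ⟨LinearMap.toMatrix' g, ?_⟩
    suffices h : (Matrix.of fun i j => ∑ l, LinearMap.toMatrix' g i l * v j l) = 1 by
      rw [h, Matrix.det_one]
      exact one_ne_zero
    ext i j
    have hgv : g (v j) = Pi.single j 1 := by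
      simpa using LinearMap.congr_fun hg (Pi.single j 1)
    calc _ = (LinearMap.toMatrix' g).mulVec (v j) i := rfl
      _ = _ := by rw [LinearMap.toMatrix'_mulVec, hgv, Matrix.one_apply, Pi.single_apply]
  · rintro ⟨L, hL⟩
    have hli := Matrix.linearIndependent_cols_iff_isUnit.2
      ((Matrix.isUnit_iff_isUnit_det _).2 hL.isUnit)
    refine LinearIndependent.of_comp L.mulVecLin ?_
    exact hli

/-! ## STATEMENT 0 -/
theorem stmt0 {k : Type*} [Field k] [IsAlgClosed k] (n m : ℕ) (h1 : 1 ≤ m) (h2 : m ≤ n) :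
    IsZariskiClosed {μ : AlgStr k n |
      ∀ a : Fin n → k, Module.finrank k ↥(subalgGen μ {a}) ≤ m} := by
  refine ⟨Set.range fun t : (Fin n → k) × (Fin (m + 1) → FreeMagma Unit) ×
    Matrix (Fin (m + 1)) (Fin n) k =>
      (Matrix.of fun i j => ∑ l, MvPolynomial.C (t.2.2 i l) * wordPoly t.1 (t.2.1 j) l).det,
    fun μ => ?_⟩
  have key (a : Fin n → k) (w : Fin (m + 1) → FreeMagma Unit)
      (L : Matrix (Fin (m + 1)) (Fin n) k) :
      MvPolynomial.eval (structConst μ)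
        (Matrix.of fun i j => ∑ l, MvPolynomial.C (L i l) * wordPoly a (w j) l).det =
      (Matrix.of fun i j => ∑ l, L i l * evalWord μ a (w j) l).det := by
    rw [RingHom.map_det]
    congr 1
    ext i j
    simp [eval_wordPoly]
  simp only [Set.forall_mem_range, Prod.forall, key]
  refine forall_congr' fun a => ?_
  rw [subalgGen_singleton_eq_span, finrank_span_range_le_iff]
  simp only [linearIndependent_iff_exists_det_ne_zero, not_exists, not_not, Function.comp_apply]

end
end

section
/- If A is a standard 1-generated algebra of dimension n ≥ 3, then lev(A) ≥ n. -/
open scoped BigOperators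

noncomputable section

variable {k : Type*} [Field k]

section Degenerations

variable {n : ℕ}

theorem mem_orbit_iff {μ χ : AlgStr k n} :
    χ ∈ orbit μ ↔ ∃ g : (Fin n → k) ≃ₗ[k] (Fin n → k), ∀ x y, g (μ x y) = χ (g x) (g y) := by
  constructor
  · rintro ⟨g, rfl⟩
    exact ⟨g, fun x y => by simp [transport]⟩
  · rintro ⟨g, hg⟩
    refine ⟨g, LinearMap.ext fun x => LinearMap.ext fun y => ?_⟩
    simp [transport, hg]

theorem orbit_subset_of_mem {μ χ : AlgStr k n} (h : χ ∈ orbit μ) : orbit χ ⊆ orbit μ := by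
  intro ψ hψ
  rw [mem_orbit_iff] at h hψ ⊢
  obtain ⟨g, hg⟩ := h
  obtain ⟨g', hg'⟩ := hψ
  exact ⟨g.trans g', fun x y => by simp [hg, hg']⟩

theorem mem_orbit_symm {μ χ : AlgStr k n} (h : χ ∈ orbit μ) : μ ∈ orbit χ := by
  rw [mem_orbit_iff] at h ⊢
  obtain ⟨g, hg⟩ := h
  exact ⟨g.symm, fun x y => g.injective (by simp [hg])⟩

theorem orbit_eq_of_mem {μ χ : AlgStr k n} (h : χ ∈ orbit μ) : orbit χ = orbit μ :=
  (orbit_subset_of_mem h).antisymm (orbit_subset_of_mem (mem_orbit_symm h))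

theorem hasChain_of_mem_orbit {μ χ : AlgStr k n} {m : ℕ} (h : χ ∈ orbit μ) (hχ : hasChain χ m) :
    hasChain μ m := by
  obtain ⟨c, hc, hstep⟩ := hχ
  refine ⟨Function.update c m μ, by simp, fun i hi => ?_⟩
  have hs := hstep i hi
  rw [Function.update_of_ne hi.ne]
  by_cases him : i + 1 = m
  · subst him
    rw [hc] at hs
    simpa [properlyDegenerates, degenerates, orbit_eq_of_mem h] using hs
  · rwa [Function.update_of_ne him]

/-- A structure degenerates to the base point of an affine line whose other points all lie in
its orbit. -/
theorem degenerates_of_line [Infinite k] {μ χ : AlgStr k n} (ψ : AlgStr k n)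
    (h : ∀ t : k, t ≠ 0 → χ + t • ψ ∈ orbit μ) : degenerates μ χ := by
  rintro T ⟨P, hP⟩ hT
  rw [hP]
  intro p hp
  let F : Fin n × Fin n × Fin n → Polynomial k := fun s =>
    Polynomial.C (structConst χ s) + Polynomial.X * Polynomial.C (structConst ψ s)
  have hF : ∀ t : k, (MvPolynomial.aeval F p).eval t =
      MvPolynomial.eval (structConst (χ + t • ψ)) p := by
    intro t
    have : (MvPolynomial.aeval F p).eval t = (Polynomial.aeval t) (MvPolynomial.aeval F p) := by
      rw [Polynomial.coe_aeval_eq_eval]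
    rw [this, ← AlgHom.comp_apply, MvPolynomial.comp_aeval]
    have hs : (fun s => Polynomial.aeval t (F s)) = structConst (χ + t • ψ) := by
      funext s
      simp [F, structConst, mul_comm t]
    rw [hs]
    rfl
  have hzero : MvPolynomial.aeval F p = 0 := by
    refine Polynomial.eq_zero_of_infinite_isRoot _ (Set.Infinite.mono (s := {0}ᶜ) ?_
      (Set.finite_singleton (0 : k)).infinite_compl)
    intro t ht
    exact (hF t).trans ((hP _).1 (hT (h t ht)) p hp)
  have := hF 0
  rw [hzero] at this
  simpa using this.symm

theorem notMem_orbit_of_map₂_lt {μ χ : AlgStr k n}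
    (h : Submodule.map₂ χ ⊤ ⊤ < Submodule.map₂ μ ⊤ ⊤) : χ ∉ orbit μ := by
  intro hmem
  obtain ⟨g, hg⟩ := mem_orbit_iff.1 hmem
  have hle : (Submodule.map₂ μ ⊤ ⊤).map g.toLinearMap ≤ Submodule.map₂ χ ⊤ ⊤ := by
    rw [Submodule.map_le_iff_le_comap, Submodule.map₂_le]
    intro x _ y _
    simpa [hg] using Submodule.apply_mem_map₂ χ (Submodule.mem_top (x := g x))
      (Submodule.mem_top (x := g y))
  have h1 := Submodule.finrank_mono hle
  rw [LinearEquiv.finrank_map_eq] at h1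
  exact (Submodule.finrank_lt_finrank_of_lt h).not_ge h1

/-- The linear automorphism scaling the coordinates `p` and `q` by `a` and `b`, followed by
subtracting `u` times the original coordinate `p` from the coordinate `q`. -/
def shear (p q : Fin n) (a b u : k) (ha : a ≠ 0) (hb : b ≠ 0) :
    (Fin n → k) ≃ₗ[k] (Fin n → k) :=
  LinearEquiv.ofInjectiveEndo
    (LinearMap.pi fun i => if i = p then a • LinearMap.proj p
      else if i = q then b • LinearMap.proj q - u • LinearMap.proj p else LinearMap.proj i) (by
    rw [injective_iff_map_eq_zero]
    intro x hx
    have hp : x p = 0 := by simpa [ha] using congrFun hx p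
    funext i
    have hi := congrFun hx i
    by_cases h1 : i = p
    · rw [h1]; exact hp
    · by_cases h2 : i = q
      · subst h2
        simpa [h1, hp, hb] using hi
      · simpa [h1, h2] using hi)

theorem shear_apply (p q : Fin n) (a b u : k) (ha : a ≠ 0) (hb : b ≠ 0)
    (x : Fin n → k) (i : Fin n) :
    shear p q a b u ha hb x i =
      if i = p then a * x p else if i = q then b * x q - u * x p else x i := by
  simp only [shear, LinearEquiv.coe_ofInjectiveEndo, LinearMap.pi_apply]
  split_ifs <;> simp

/-- The structure with `e_o e_o = c • e_p + c' • e_q`, `e_o e_p = α • e_q`, `e_p e_o = β • e_q`,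
`e_p e_p = γ • e_q`. -/
def triStr (o p q : Fin n) (c c' α β γ : k) : AlgStr k n :=
  LinearMap.mk₂ k (fun x y => Pi.single p (c * (x o * y o)) +
      Pi.single q (c' * (x o * y o) + α * (x o * y p) + β * (x p * y o) + γ * (x p * y p)))
    (fun x x' y => by
      ext i; simp only [Pi.add_apply, Pi.single_apply]; split_ifs <;> ring)
    (fun s x y => by
      ext i; simp only [Pi.add_apply, Pi.smul_apply, smul_eq_mul, Pi.single_apply]
      split_ifs <;> ring)
    (fun x y y' => by
      ext i; simp only [Pi.add_apply, Pi.single_apply]; split_ifs <;> ring)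
    (fun s x y => by
      ext i; simp only [Pi.add_apply, Pi.smul_apply, smul_eq_mul, Pi.single_apply]
      split_ifs <;> ring)

theorem triStr_apply (o p q : Fin n) (c c' α β γ : k) (x y : Fin n → k) (i : Fin n) :
    triStr o p q c c' α β γ x y i = (if i = p then c * (x o * y o) else 0) +
      if i = q then
        c' * (x o * y o) + α * (x o * y p) + β * (x p * y o) + γ * (x p * y p) else 0 := by
  simp [triStr, Pi.single_apply]

/-- The structure `triStr` degenerates to one whose product takes values in a line; if `γ = 0` the
mixed products survive. -/
theorem triStr_degenerates_mixed [Infinite k] {o p q : Fin n} (hop : o ≠ p) (hoq : o ≠ q)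
    (hpq : p ≠ q) {c : k} (hc : c ≠ 0) (c' α β : k) :
    degenerates (triStr o p q c c' α β 0) (triStr o p q 0 1 α β 0) := by
  refine degenerates_of_line (triStr o p q c 0 0 0 0) fun t ht => mem_orbit_iff.2
    ⟨shear p q t t ((t * c' - 1) / c) ht ht, fun x y => funext fun i => ?_⟩
  simp only [LinearMap.add_apply, LinearMap.smul_apply, Pi.add_apply, Pi.smul_apply, smul_eq_mul,
    triStr_apply, shear_apply, if_true, if_neg hop, if_neg hoq, if_neg hpq, if_neg hpq.symm]
  split_ifs with h1 h2
  · exact absurd (h1.symm.trans h2) hpq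
  · ring
  · field_simp
    ring
  · ring

theorem triStr_degenerates_square [Infinite k] {o p q : Fin n} (hop : o ≠ p) (hoq : o ≠ q)
    (hpq : p ≠ q) {c : k} (hc : c ≠ 0) (c' α β γ : k) :
    degenerates (triStr o p q c c' α β γ) (triStr o p q 0 1 0 0 γ) := by
  refine degenerates_of_line (triStr o p q c 0 α β 0) fun t ht => mem_orbit_iff.2
    ⟨shear p q t (t ^ 2) ((t ^ 2 * c' - 1) / c) ht (pow_ne_zero 2 ht),
      fun x y => funext fun i => ?_⟩
  simp only [LinearMap.add_apply, LinearMap.smul_apply, Pi.add_apply, Pi.smul_apply, smul_eq_mul,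
    triStr_apply, shear_apply, if_true, if_neg hop, if_neg hoq, if_neg hpq, if_neg hpq.symm]
  split_ifs with h1 h2
  · exact absurd (h1.symm.trans h2) hpq
  · ring
  · field_simp
    ring
  · ring

theorem triStr_mixed_degenerates [Infinite k] {o p q : Fin n} (hop : o ≠ p) (hoq : o ≠ q)
    (hpq : p ≠ q) (α β : k) :
    degenerates (triStr o p q 0 1 α β 0) (triStr o p q 0 1 0 0 0) := by
  refine degenerates_of_line (triStr o p q 0 0 α β 0) fun t ht => mem_orbit_iff.2
    ⟨shear p q t⁻¹ 1 0 (inv_ne_zero ht) one_ne_zero, fun x y => funext fun i => ?_⟩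
  simp only [LinearMap.add_apply, LinearMap.smul_apply, Pi.add_apply, Pi.smul_apply, smul_eq_mul,
    triStr_apply, shear_apply, if_true, if_neg hop, if_neg hoq, if_neg hpq, if_neg hpq.symm]
  split_ifs with h1 h2
  · exact absurd (h1.symm.trans h2) hpq
  · ring
  · field_simp
    ring
  · ring

theorem triStr_square_degenerates [IsAlgClosed k] {o p q : Fin n} (hop : o ≠ p) (hoq : o ≠ q)
    (hpq : p ≠ q) (γ : k) :
    degenerates (triStr o p q 0 1 0 0 γ) (triStr o p q 0 1 0 0 0) := by
  have : Infinite k := IsAlgClosed.instInfinite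
  refine degenerates_of_line (triStr o p q 0 0 0 0 γ) fun t ht => mem_orbit_iff.2 ?_
  obtain ⟨r, rfl⟩ := IsAlgClosed.exists_pow_nat_eq t zero_lt_two
  have hr : r ≠ 0 := by rintro rfl; simp at ht
  refine ⟨shear p q r⁻¹ 1 0 (inv_ne_zero hr) one_ne_zero, fun x y => funext fun i => ?_⟩
  simp only [LinearMap.add_apply, LinearMap.smul_apply, Pi.add_apply, Pi.smul_apply, smul_eq_mul,
    triStr_apply, shear_apply, if_true, if_neg hop, if_neg hoq, if_neg hpq, if_neg hpq.symm]
  split_ifs with h1 h2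
  · exact absurd (h1.symm.trans h2) hpq
  · ring
  · field_simp
    ring
  · ring

theorem triStr_degenerates_zero [Infinite k] {o p q : Fin n} (hop : o ≠ p) (hoq : o ≠ q)
    (hpq : p ≠ q) : degenerates (triStr o p q 0 (1 : k) 0 0 0) 0 := by
  refine degenerates_of_line (triStr o p q 0 1 0 0 0) fun t ht => mem_orbit_iff.2
    ⟨shear p q 1 t 0 one_ne_zero ht, fun x y => funext fun i => ?_⟩
  simp only [LinearMap.add_apply, LinearMap.smul_apply, Pi.add_apply, Pi.smul_apply, smul_eq_mul,
    triStr_apply, shear_apply, if_true, if_neg hop, if_neg hoq, if_neg hpq, if_neg hpq.symm]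
  split_ifs with h1 h2
  · exact absurd (h1.symm.trans h2) hpq
  · simp
  · simp
  · simp

theorem zero_notMem_orbit {μ : AlgStr k n} (h : μ ≠ 0) : (0 : AlgStr k n) ∉ orbit μ := by
  intro hmem
  obtain ⟨g, hg⟩ := mem_orbit_iff.1 hmem
  exact h (LinearMap.ext fun x => LinearMap.ext fun y => g.injective (by simp [hg]))

/-- In `e_o e_o = e_q`, square-zero elements annihilate the whole algebra. -/
theorem triStr_notMem_orbit {o p q : Fin n} (hpq : p ≠ q) {μ : AlgStr k n} {x y : Fin n → k}
    (hx : μ x x = 0) (hxy : μ x y ≠ 0 ∨ μ y x ≠ 0) :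
    triStr o p q 0 1 0 0 0 ∉ orbit μ := by
  intro hmem
  obtain ⟨g, hg⟩ := mem_orbit_iff.1 hmem
  have h0 : g x o = 0 := by
    have := congrFun (hg x x) q
    simpa [hx, triStr_apply, hpq.symm] using this.symm
  rcases hxy with h | h
  · exact h (g.injective (funext fun i => by rw [hg]; simp [triStr_apply, h0]))
  · exact h (g.injective (funext fun i => by rw [hg]; simp [triStr_apply, h0]))

/-- Composition of a product with the projection onto the first `m` coordinates. -/
def trunc (m : ℕ) (μ : AlgStr k n) : AlgStr k n :=
  μ.compr₂ (LinearMap.pi fun i => if (i : ℕ) < m then LinearMap.proj i else 0)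

theorem trunc_apply (m : ℕ) (μ : AlgStr k n) (x y : Fin n → k) (i : Fin n) :
    trunc m μ x y i = if (i : ℕ) < m then μ x y i else 0 := by
  simp only [trunc, LinearMap.compr₂_apply, LinearMap.pi_apply]
  split_ifs <;> simp

theorem trunc_self (μ : AlgStr k n) : trunc n μ = μ := by
  refine LinearMap.ext fun x => LinearMap.ext fun y => funext fun i => ?_
  simp [trunc_apply]

/-- The products of basis vectors are strictly triangular with respect to the standard flag. -/
def IsStrictlyTriangular (μ : AlgStr k n) : Prop :=
  ∀ i j l, μ (Pi.single i 1) (Pi.single j 1) l ≠ 0 → i < l ∧ j < l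

theorem trunc_degenerates [Infinite k] {μ : AlgStr k n} (hμ : IsStrictlyTriangular μ) {m : ℕ}
    (hm0 : 0 < m) (hm : m < n) : degenerates (trunc (m + 1) μ) (trunc m μ) := by
  let q : Fin n := ⟨m, hm⟩
  let o : Fin n := ⟨0, hm0.trans hm⟩
  have hoq : o ≠ q := by simp [o, q, Fin.ext_iff, hm0.ne]
  refine degenerates_of_line
    (μ.compr₂ ((LinearMap.single k (fun _ => k) q).comp (LinearMap.proj q)))
    fun t ht => mem_orbit_iff.2 ⟨shear o q 1 t 0 one_ne_zero ht, ?_⟩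
  set g := shear o q 1 t 0 one_ne_zero ht with hgdef
  have hg : ∀ (x : Fin n → k) (i : Fin n), g x i = if i = q then t * x i else x i := by
    intro x i
    rw [hgdef, shear_apply]
    by_cases h1 : i = o
    · simp [h1, hoq]
    · by_cases h2 : i = q <;> simp [h1, h2, hoq.symm]
  have hsingle : ∀ i : Fin n, g (Pi.single i 1) = (if i = q then t else 1) • Pi.single i 1 := by
    intro i
    funext j
    rw [hg]
    by_cases h1 : j = i
    · subst h1; simp
    · simp [h1]
  have key : ∀ x y (l : Fin n), (l : ℕ) ≤ m → μ (g x) (g y) l = μ x y l := by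
    intro x y l hl
    have : ((μ.comp g.toLinearMap).compl₂ g.toLinearMap).compr₂ (LinearMap.proj l) =
        μ.compr₂ (LinearMap.proj l) := by
      refine (Pi.basisFun k (Fin n)).ext fun i => (Pi.basisFun k (Fin n)).ext fun j => ?_
      simp only [Pi.basisFun_apply, LinearMap.compr₂_apply, LinearMap.compl₂_apply,
        LinearMap.comp_apply, LinearEquiv.coe_coe, hsingle, LinearMap.proj_apply, map_smul,
        LinearMap.smul_apply, smul_eq_mul]
      by_cases h0 : μ (Pi.single i 1) (Pi.single j 1) l = 0
      · simp [h0]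
      · obtain ⟨h1, h2⟩ := hμ i j l h0
        rw [if_neg, if_neg]
        · simp
        · rintro rfl; exact absurd h1 (not_lt.2 hl)
        · rintro rfl; exact absurd h2 (not_lt.2 hl)
    simpa using LinearMap.congr_fun₂ this x y
  intro x y
  funext l
  rw [hg]
  simp only [LinearMap.add_apply, LinearMap.smul_apply, Pi.add_apply, Pi.smul_apply, smul_eq_mul,
    trunc_apply, LinearMap.compr₂_apply, LinearMap.comp_apply, LinearMap.proj_apply,
    LinearMap.single_apply, Pi.single_apply]
  by_cases h1 : l = q
  · subst h1
    simp [q, key]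
  · have h2 : (l : ℕ) ≠ m := fun h => h1 (Fin.ext h)
    by_cases h3 : (l : ℕ) < m
    · simp [h1, h3, h3.trans (Nat.lt_succ_self m), key x y l h3.le]
    · have : ¬ (l : ℕ) < m + 1 := by omega
      simp [h1, h3, this]

theorem mem_map₂_trunc {μ : AlgStr k n} {x : Fin n → k} {m : ℕ}
    (hx : x ∈ Submodule.map₂ μ ⊤ ⊤) (hm : ∀ i : Fin n, m ≤ (i : ℕ) → x i = 0) :
    x ∈ Submodule.map₂ (trunc m μ) ⊤ ⊤ := by
  rw [trunc, ← Submodule.map_map₂]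
  refine ⟨x, hx, funext fun i => ?_⟩
  simp only [LinearMap.pi_apply]
  split_ifs with h
  · simp
  · simp [hm i (not_lt.1 h)]

theorem map₂_trunc_lt {μ : AlgStr k n} {m : ℕ} (hm : m < n)
    (hmem : Pi.single ⟨m, hm⟩ 1 ∈ Submodule.map₂ μ ⊤ ⊤)
    (hclosed : ∀ x ∈ Submodule.map₂ μ ⊤ ⊤, ∀ r : ℕ,
      (fun i : Fin n => if (i : ℕ) < r then x i else 0) ∈ Submodule.map₂ μ ⊤ ⊤) :
    Submodule.map₂ (trunc m μ) ⊤ ⊤ < Submodule.map₂ (trunc (m + 1) μ) ⊤ ⊤ := by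
  rw [SetLike.lt_iff_le_and_exists]
  refine ⟨Submodule.map₂_le.2 fun x _ y _ => ?_, Pi.single ⟨m, hm⟩ 1,
    mem_map₂_trunc hmem fun i hi => ?_, fun h => ?_⟩
  · refine mem_map₂_trunc ?_ fun i hi => ?_
    · convert hclosed (μ x y) (Submodule.apply_mem_map₂ μ trivial trivial) m using 1
      funext i
      rw [trunc_apply]
    · rw [trunc_apply, if_neg (by omega)]
  · rw [Pi.single_eq_of_ne]
    rintro rfl
    simp at hi
  · have hle : Submodule.map₂ (trunc m μ) ⊤ ⊤ ≤
        LinearMap.ker (LinearMap.proj (⟨m, hm⟩ : Fin n) : (Fin n → k) →ₗ[k] k) := by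
      refine Submodule.map₂_le.2 fun x _ y _ => ?_
      simp [trunc_apply]
    simpa using hle h

theorem hasChain_of_isStrictlyTriangular [IsAlgClosed k] (hn : 3 ≤ n) {μ : AlgStr k n}
    (hμ : IsStrictlyTriangular μ)
    (hspan : ∀ x : Fin n → k, x ⟨0, by omega⟩ = 0 → x ∈ Submodule.map₂ μ ⊤ ⊤) :
    hasChain μ n := by
  have : Infinite k := IsAlgClosed.instInfinite
  let o : Fin n := ⟨0, by omega⟩
  let p : Fin n := ⟨1, by omega⟩
  let q : Fin n := ⟨2, by omega⟩
  have hop : o ≠ p := by simp [o, p]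
  have hoq : o ≠ q := by simp [o, q]
  have hpq : p ≠ q := by simp [p, q]
  have hzero : ∀ {i j l : Fin n}, (l ≤ i ∨ l ≤ j) →
      μ (Pi.single i 1) (Pi.single j 1) l = 0 := by
    intro i j l h
    by_contra h0
    obtain ⟨h1, h2⟩ := hμ i j l h0
    rcases h with h | h
    · exact absurd h1 (not_lt.2 h)
    · exact absurd h2 (not_lt.2 h)
  obtain ⟨c, c', α, β, γ, h3⟩ : ∃ c c' α β γ, trunc 3 μ = triStr o p q c c' α β γ := by
    refine ⟨μ (Pi.single o 1) (Pi.single o 1) p, μ (Pi.single o 1) (Pi.single o 1) q,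
      μ (Pi.single o 1) (Pi.single p 1) q, μ (Pi.single p 1) (Pi.single o 1) q,
      μ (Pi.single p 1) (Pi.single p 1) q, ?_⟩
    refine (Pi.basisFun k (Fin n)).ext fun i => (Pi.basisFun k (Fin n)).ext fun j =>
      funext fun l => ?_
    simp only [Pi.basisFun_apply, trunc_apply, triStr_apply]
    have cases3 : ∀ i : Fin n, i = o ∨ i = p ∨ q ≤ i := by
      intro i
      simp only [o, p, q, Fin.ext_iff, Fin.le_def]
      omega
    have hlo : l = o ∨ l = p ∨ l = q ∨ 3 ≤ (l : ℕ) := by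
      simp only [o, p, q, Fin.ext_iff]
      omega
    have ho3 : (o : ℕ) < 3 := by simp [o]
    have hp3 : (p : ℕ) < 3 := by simp [p]
    have hq3 : (q : ℕ) < 3 := by simp [q]
    have hoi : ∀ i, o ≤ i := fun i => by simp [o, Fin.le_def]
    have hpq' : p ≤ q := by simp [p, q, Fin.le_def]
    rcases hlo with rfl | rfl | rfl | hl
    · rw [hzero (Or.inl (hoi i))]
      simp [hop, hoq]
    · rcases cases3 i with rfl | rfl | hi
      · rcases cases3 j with rfl | rfl | hj
        · simp [hpq, hp3]
        · rw [hzero (Or.inr le_rfl)]; simp [hpq, hop]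
        · have : o ≠ j := by rintro rfl; simp [o, q, Fin.le_def] at hj
          rw [hzero (Or.inr (hpq'.trans hj))]; simp [hpq, this]
      · rw [hzero (Or.inl le_rfl)]; simp [hpq, hop]
      · have : o ≠ i := by rintro rfl; simp [o, q, Fin.le_def] at hi
        rw [hzero (Or.inl (hpq'.trans hi))]; simp [hpq, this]
    · have hne : ∀ {i : Fin n}, q ≤ i → o ≠ i ∧ p ≠ i := by
        intro i hi
        constructor <;> rintro rfl <;> simp [o, p, q, Fin.le_def] at hi
      rcases cases3 i with rfl | rfl | hi
      · rcases cases3 j with rfl | rfl | hj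
        · simp [hpq.symm, hop.symm, hq3]
        · simp [hpq.symm, hop.symm, hop, hq3]
        · rw [hzero (Or.inr hj)]; simp [hpq.symm, (hne hj).1, (hne hj).2]
      · rcases cases3 j with rfl | rfl | hj
        · simp [hpq.symm, hop.symm, hop, hq3]
        · simp [hpq.symm, hop, hq3]
        · rw [hzero (Or.inr hj)]; simp [hpq.symm, (hne hj).1, (hne hj).2]
      · rw [hzero (Or.inl hi)]; simp [hpq.symm, (hne hi).1, (hne hi).2]
    · have h1 : l ≠ p := by rintro rfl; simp [p] at hl
      have h2 : l ≠ q := by rintro rfl; simp [q] at hl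
      simp [h1, h2, not_lt.2 hl]
  have hmem3 : ∀ i : Fin n, i ≠ o → (i : ℕ) < 3 → (Pi.single i 1 : Fin n → k) ∈
      Submodule.map₂ (triStr o p q c c' α β γ) ⊤ ⊤ := by
    intro i hi hi3
    rw [← h3]
    refine mem_map₂_trunc (hspan _ (Pi.single_eq_of_ne hi.symm 1)) fun j hj => ?_
    rw [Pi.single_eq_of_ne]
    rintro rfl
    omega
  have hp := hmem3 p hop.symm (by simp [p])
  have hq := hmem3 q hoq.symm (by simp [q])
  have hc : c ≠ 0 := by
    rintro rfl
    have hle : Submodule.map₂ (triStr o p q 0 c' α β γ) ⊤ ⊤ ≤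
        LinearMap.ker (LinearMap.proj p : (Fin n → k) →ₗ[k] k) :=
      Submodule.map₂_le.2 fun x _ y _ => by simp [triStr_apply, hpq]
    simpa using hle hp
  have hαβγ : γ = 0 → α ≠ 0 ∨ β ≠ 0 := by
    rintro rfl
    by_contra! h
    obtain ⟨rfl, rfl⟩ := h
    have hle : Submodule.map₂ (triStr o p q c c' 0 0 0) ⊤ ⊤ ≤
        LinearMap.ker (c' • LinearMap.proj p - c • LinearMap.proj q : (Fin n → k) →ₗ[k] k) :=
      Submodule.map₂_le.2 fun x _ y _ => by
        simp only [LinearMap.mem_ker, LinearMap.sub_apply, LinearMap.smul_apply,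
          LinearMap.proj_apply, triStr_apply, smul_eq_mul, if_true, if_neg hpq, if_neg hpq.symm]
        ring
    have := hle hq
    simp [hpq, hc] at this
  obtain ⟨F, hF3, hFlt, hFG, hGF⟩ : ∃ F : AlgStr k n, degenerates (trunc 3 μ) F ∧
      (∀ x y, F x y p = 0 ∧ ∀ i ≠ q, F x y i = 0) ∧
      degenerates F (triStr o p q 0 1 0 0 0) ∧ triStr o p q 0 1 0 0 0 ∉ orbit F := by
    rw [h3]
    by_cases hγ : γ = 0
    · subst hγ
      refine ⟨triStr o p q 0 1 α β 0, triStr_degenerates_mixed hop hoq hpq hc c' α β,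
        fun x y => ⟨by simp [triStr_apply, hpq], fun i hi => by simp [triStr_apply, hi]⟩,
        triStr_mixed_degenerates hop hoq hpq α β,
        triStr_notMem_orbit (x := Pi.single p 1) (y := Pi.single o 1) hpq ?_ ?_⟩
      · funext i
        simp [triStr_apply, hop]
      · rcases hαβγ rfl with h | h
        · refine Or.inr fun h0 => h ?_
          simpa [triStr_apply, hop, hop.symm, hpq.symm] using congrFun h0 q
        · refine Or.inl fun h0 => h ?_
          simpa [triStr_apply, hop, hop.symm, hpq.symm] using congrFun h0 q
    · obtain ⟨r, hr⟩ := IsAlgClosed.exists_pow_nat_eq (-γ⁻¹) zero_lt_two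
      refine ⟨triStr o p q 0 1 0 0 γ, triStr_degenerates_square hop hoq hpq hc c' α β γ,
        fun x y => ⟨by simp [triStr_apply, hpq], fun i hi => by simp [triStr_apply, hi]⟩,
        triStr_square_degenerates hop hoq hpq γ,
        triStr_notMem_orbit (x := Pi.single o 1 + Pi.single p r) (y := Pi.single o 1) hpq ?_
          (Or.inl fun h0 => ?_)⟩
      · have : 1 + γ * (r * r) = 0 := by
          rw [← pow_two, hr]
          field_simp
          ring
        funext i
        by_cases hi : i = q <;> simp [triStr_apply, hop, hop.symm, hi, this]
      · simpa [triStr_apply, hop, hop.symm, hpq.symm] using congrFun h0 q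
  have hFnot : F ∉ orbit (trunc 3 μ) := by
    refine notMem_orbit_of_map₂_lt ?_
    rw [h3, SetLike.lt_iff_le_and_exists]
    refine ⟨Submodule.map₂_le.2 fun x _ y _ => ?_, Pi.single p 1, hp, fun h => ?_⟩
    · have : F x y = F x y q • Pi.single q 1 := by
        funext i
        by_cases hi : i = q
        · subst hi; simp
        · simp [hi, (hFlt x y).2 i hi]
      rw [this]
      exact Submodule.smul_mem _ _ hq
    · have hle : Submodule.map₂ F ⊤ ⊤ ≤
          LinearMap.ker (LinearMap.proj p : (Fin n → k) →ₗ[k] k) :=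
        Submodule.map₂_le.2 fun x _ y _ => by simp [(hFlt x y).1]
      simpa using hle h
  have hμo : ∀ x ∈ Submodule.map₂ μ ⊤ ⊤, x o = 0 := by
    have hle : Submodule.map₂ μ ⊤ ⊤ ≤
        LinearMap.ker (LinearMap.proj o : (Fin n → k) →ₗ[k] k) := by
      have h0 : μ.compr₂ (LinearMap.proj o) = 0 := by
        refine (Pi.basisFun k (Fin n)).ext fun i => (Pi.basisFun k (Fin n)).ext fun j => ?_
        simpa using hzero (i := i) (j := j) (l := o) (Or.inl (by simp [o, Fin.le_def]))
      exact Submodule.map₂_le.2 fun x _ y _ => by simpa using LinearMap.congr_fun₂ h0 x y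
    exact fun x hx => hle hx
  refine ⟨fun i => match i with
    | 0 => 0
    | 1 => triStr o p q 0 1 0 0 0
    | 2 => F
    | m + 3 => trunc (m + 3) μ, ?_, ?_⟩
  · obtain ⟨m, rfl⟩ := Nat.exists_eq_add_of_le' hn
    exact trunc_self μ
  · intro i hi
    match i with
    | 0 =>
      refine ⟨triStr_degenerates_zero hop hoq hpq, zero_notMem_orbit fun h => ?_⟩
      have := congrFun (LinearMap.congr_fun₂ h (Pi.single o 1) (Pi.single o 1)) q
      simp [triStr_apply, hop.symm] at this
    | 1 => exact ⟨hFG, hGF⟩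
    | 2 => exact ⟨hF3, hFnot⟩
    | m + 3 =>
      refine ⟨trunc_degenerates hμ (by omega) hi,
        notMem_orbit_of_map₂_lt (map₂_trunc_lt hi (hspan _ ?_) fun x hx r => hspan _ ?_)⟩
      · exact Pi.single_eq_of_ne (by simp [Fin.ext_iff]) 1
      · simpa using fun _ => hμo x hx

theorem StandardOneGenerated.exists_isStrictlyTriangular {μ : AlgStr k n} (hn : 0 < n)
    (h : StandardOneGenerated μ) : ∃ χ ∈ orbit μ, IsStrictlyTriangular χ ∧
      ∀ x : Fin n → k, x ⟨0, hn⟩ = 0 → x ∈ Submodule.map₂ χ ⊤ ⊤ := by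
  obtain ⟨A, hA0, hA, hA1, hmul, hgen⟩ := h
  let B := hA.collectedBasis fun i => Module.finBasis k (A i)
  have : Fintype (Σ i, Fin (Module.finrank k (A i))) :=
    FiniteDimensional.fintypeBasisIndex B
  have hcard : Fintype.card (Σ i, Fin (Module.finrank k (A i))) = n := by
    rw [← Module.finrank_eq_card_basis B, Module.finrank_fin_fun]
  let e := Fintype.equivFinOfCardEq hcard
  let f : Fin n → ℕ := fun i => (e.symm i).1
  let σ := Tuple.sort f
  let b := B.reindex (e.trans σ.symm)
  let d : Fin n → ℕ := f ∘ σ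
  have hd : Monotone d := Tuple.monotone_sort f
  have hb : ∀ i, b i ∈ A (d i) := fun i => by
    have := hA.collectedBasis_mem (fun i => Module.finBasis k (A i)) (e.symm (σ i))
    simpa only [b, B, d, f, Module.Basis.reindex_apply, Equiv.symm_trans_apply, Equiv.symm_symm,
      Function.comp_apply] using this
  have hrepr : ∀ {x : Fin n → k} {r : ℕ} {l : Fin n}, x ∈ A r → b.repr x l ≠ 0 → d l = r := by
    intro x r l hx hl
    by_contra hne
    apply hl
    rw [Module.Basis.repr_reindex_apply]
    exact hA.collectedBasis_repr_of_mem_ne (fun i => Module.finBasis k (A i))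
      (a := (e.symm (σ l)).2) (Ne.symm hne) hx
  have hpos : ∀ i, 0 < d i := by
    intro i
    rw [Nat.pos_iff_ne_zero]
    intro h0
    have := hb i
    rw [h0, hA0, Submodule.mem_bot] at this
    exact b.ne_zero i this
  let g : (Fin n → k) ≃ₗ[k] (Fin n → k) := b.equivFun
  have hg : ∀ i, g.symm (Pi.single i 1) = b i := fun i => by
    rw [LinearEquiv.symm_apply_eq]
    simp [g, Finsupp.single_eq_pi_single]
  have htri : IsStrictlyTriangular (transport g μ) := by
    intro i j l hl
    have hl' : b.repr (μ (b i) (b j)) l ≠ 0 := by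
      simpa [transport, hg, g] using hl
    have := hrepr (hmul _ _ _ (hb i) _ (hb j)) hl'
    have h1 := hpos i
    have h2 := hpos j
    exact ⟨hd.reflect_lt (by omega), hd.reflect_lt (by omega)⟩
  refine ⟨transport g μ, ⟨g, rfl⟩, htri, ?_⟩
  have hsup : A 1 ⊔ Submodule.map₂ μ ⊤ ⊤ = ⊤ := by
    refine top_le_iff.1 (hgen.ge.trans ?_)
    exact sInf_le ⟨SetLike.coe_subset_coe.2 le_sup_left, fun x _ y _ =>
      Submodule.mem_sup_right (Submodule.apply_mem_map₂ μ trivial trivial)⟩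
  have hrank : n ≤ 1 + Module.finrank k (Submodule.map₂ (transport g μ) ⊤ ⊤) := by
    have h1 := Submodule.finrank_add_le_finrank_add_finrank (A 1) (Submodule.map₂ μ ⊤ ⊤)
    rw [hsup, finrank_top, Module.finrank_fin_fun, hA1,
      ← LinearEquiv.finrank_map_eq g (Submodule.map₂ μ ⊤ ⊤)] at h1
    refine h1.trans (Nat.add_le_add_left (Submodule.finrank_mono ?_) 1)
    rw [Submodule.map_le_iff_le_comap, Submodule.map₂_le]
    intro x _ y _
    simpa [transport] using Submodule.apply_mem_map₂ (transport g μ)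
      (Submodule.mem_top (x := g x)) (Submodule.mem_top (x := g y))
  let K : Submodule k (Fin n → k) := LinearMap.ker (LinearMap.proj (⟨0, hn⟩ : Fin n))
  have hle : Submodule.map₂ (transport g μ) ⊤ ⊤ ≤ K := by
    have h0 : (transport g μ).compr₂ (LinearMap.proj (⟨0, hn⟩ : Fin n)) = 0 := by
      refine (Pi.basisFun k (Fin n)).ext fun i => (Pi.basisFun k (Fin n)).ext fun j => ?_
      by_contra hne
      have := (htri i j ⟨0, hn⟩ (by simpa using hne)).1
      simp [Fin.lt_def] at this
    exact Submodule.map₂_le.2 fun x _ y _ => by simpa [K] using LinearMap.congr_fun₂ h0 x y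
  have hK : Module.finrank k K < n := by
    have hlt : K < ⊤ := by
      rw [lt_top_iff_ne_top]
      intro htop
      have : (Pi.single ⟨0, hn⟩ 1 : Fin n → k) ∈ K := htop ▸ trivial
      simp [K] at this
    simpa using Submodule.finrank_lt hlt.ne
  have heq := Submodule.eq_of_le_of_finrank_le hle (by omega)
  intro x hx
  rw [heq]
  exact hx

end Degenerations

/-! ## STATEMENT 2 -/
theorem stmt2 {k : Type*} [Field k] [IsAlgClosed k] (n : ℕ) (hn : 3 ≤ n)
    (μ : AlgStr k n) (h : StandardOneGenerated μ) : hasChain μ n := by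
  obtain ⟨χ, hχ, htri, hspan⟩ := h.exists_isStrictlyTriangular (by omega)
  exact hasChain_of_mem_orbit hχ (hasChain_of_isStrictlyTriangular hn htri hspan)

end
end

section
/- Let μ ∈ A_n satisfy μ(e_i,e_j) = 0 for all 2 ≤ i,j ≤ n and μ(e_1,e_i), μ(e_i,e_1) ∈ span(e_2,…,e_n) for all 2 ≤ i ≤ n. Then G(μ) = 1 if and only if there exists α ∈ k such that μ(e_1,e_1) = αe_1 and μ(e_1,e_i) + μ(e_i,e_1) = αe_i for every 2 ≤ i ≤ n. -/
open scoped BigOperators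

noncomputable section

variable {k : Type*} [Field k]

theorem sum_smul_unitVec {n : ℕ} (x : Fin n → k) :
    ∑ i : Fin n, x i • unitVec n (i : ℕ) = x := by
  funext j
  simp [unitVec, Finset.sum_apply, Fin.val_inj]

theorem mem_subalgGen_self {n : ℕ} (μ : AlgStr k n) (a : Fin n → k) :
    a ∈ subalgGen μ {a} :=
  Submodule.mem_sInf.2 fun _ hW => hW.1 rfl

theorem mul_self_mem_subalgGen {n : ℕ} (μ : AlgStr k n) (a : Fin n → k) :
    μ a a ∈ subalgGen μ {a} :=
  Submodule.mem_sInf.2 fun _ hW => hW.2 a (hW.1 rfl) a (hW.1 rfl)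

theorem subalgGen_eq_span {n : ℕ} (μ : AlgStr k n) {a : Fin n → k} {c : k}
    (h : μ a a = c • a) : subalgGen μ {a} = Submodule.span k {a} := by
  refine le_antisymm (sInf_le ⟨Submodule.subset_span, ?_⟩) ?_
  · intro x hx y hy
    obtain ⟨s, rfl⟩ := Submodule.mem_span_singleton.1 hx
    obtain ⟨t, rfl⟩ := Submodule.mem_span_singleton.1 hy
    simp only [map_smul, LinearMap.smul_apply, h]
    exact Submodule.smul_mem _ _ (Submodule.smul_mem _ _
      (Submodule.smul_mem _ _ (Submodule.mem_span_singleton_self a)))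
  · rw [Submodule.span_singleton_le_iff_mem]
    exact mem_subalgGen_self μ a

/-- In a nonzero space, the generation type is `1` iff every square `μ a a` is a multiple
of `a`. -/
theorem genType_one_iff {n : ℕ} (hn : 0 < n) (μ : AlgStr k n) :
    genType μ 1 ↔ ∀ a : Fin n → k, ∃ c : k, μ a a = c • a := by
  constructor
  · intro h a
    by_cases ha : a = 0
    · exact ⟨0, by simp [ha]⟩
    have hle : Module.finrank k (subalgGen μ {a}) ≤ 1 := h.2 ⟨a, rfl⟩
    have hspan : Submodule.span k {a} = subalgGen μ {a} := by
      refine Submodule.eq_of_le_of_finrank_le ?_ (by rwa [finrank_span_singleton ha])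
      rw [Submodule.span_singleton_le_iff_mem]
      exact mem_subalgGen_self μ a
    have hmem := mul_self_mem_subalgGen μ a
    rw [← hspan, Submodule.mem_span_singleton] at hmem
    exact hmem.imp fun _ hc => hc.symm
  · intro h
    constructor
    · obtain ⟨c, hc⟩ := h (unitVec n 0)
      refine ⟨unitVec n 0, ?_⟩
      rw [subalgGen_eq_span μ hc]
      refine finrank_span_singleton fun h0 => ?_
      simpa [unitVec] using congrFun h0 ⟨0, hn⟩
    · rintro d ⟨a, rfl⟩
      obtain ⟨c, hc⟩ := h a
      rw [subalgGen_eq_span μ hc]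
      exact finrank_span_le_card _ |>.trans (by simp)

/-! ## STATEMENT 4 -/
theorem stmt4 {k : Type*} [Field k] [IsAlgClosed k] (n : ℕ) (hn : 0 < n) (μ : AlgStr k n)
    (h1 : ∀ i j : ℕ, 1 ≤ i → i < n → 1 ≤ j → j < n →
      μ (unitVec n i) (unitVec n j) = 0)
    (h2 : ∀ i : ℕ, 1 ≤ i → i < n →
      μ (unitVec n 0) (unitVec n i) ⟨0, hn⟩ = 0 ∧ μ (unitVec n i) (unitVec n 0) ⟨0, hn⟩ = 0) :
    genType μ 1 ↔
      ∃ α : k, μ (unitVec n 0) (unitVec n 0) = α • unitVec n 0 ∧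
        ∀ i : ℕ, 1 ≤ i → i < n →
          μ (unitVec n 0) (unitVec n i) + μ (unitVec n i) (unitVec n 0) = α • unitVec n i := by
  rw [genType_one_iff hn]
  constructor
  · intro h
    obtain ⟨α, hα⟩ := h (unitVec n 0)
    refine ⟨α, hα, fun i hi hin => ?_⟩
    obtain ⟨c, hc⟩ := h (unitVec n 0 + unitVec n i)
    have hexp : α • unitVec n 0 +
        (μ (unitVec n 0) (unitVec n i) + μ (unitVec n i) (unitVec n 0)) =
          c • (unitVec n 0 + unitVec n i) := by
      rw [← hc, ← hα]
      simp only [map_add, LinearMap.add_apply, h1 i i hi hin hi hin]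
      abel
    have hαc : α = c := by
      have h0 := congrFun hexp ⟨0, hn⟩
      have hi0 : 0 ≠ i := by omega
      simpa [unitVec, hi0, (h2 i hi hin).1, (h2 i hi hin).2] using h0
    rw [← hαc, smul_add] at hexp
    exact add_left_cancel hexp
  · rintro ⟨α, hα, hs⟩ x
    set y : Fin n → k := x - x ⟨0, hn⟩ • unitVec n 0 with hy
    have hy0 : y ⟨0, hn⟩ = 0 := by simp [hy, unitVec]
    have hpos : ∀ i : Fin n, y i ≠ 0 → 1 ≤ (i : ℕ) := by
      intro i hi
      by_contra hlt
      have : i = ⟨0, hn⟩ := Fin.ext (by simp; omega)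
      exact hi (this ▸ hy0)
    have hyy : μ y y = 0 := by
      rw [← sum_smul_unitVec y]
      simp only [map_sum, map_smul, LinearMap.sum_apply, LinearMap.smul_apply]
      refine Finset.sum_eq_zero fun i _ => ?_
      by_cases hi : y i = 0
      · simp [hi]
      rw [Finset.sum_eq_zero, smul_zero]
      intro j _
      by_cases hj : y j = 0
      · simp [hj]
      rw [h1 _ _ (hpos _ ‹_›) (Fin.is_lt _) (hpos _ ‹_›) (Fin.is_lt _), smul_zero]
    have hey : μ (unitVec n 0) y + μ y (unitVec n 0) = α • y := by
      conv_lhs => rw [← sum_smul_unitVec y]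
      conv_rhs => rw [← sum_smul_unitVec y]
      simp only [map_sum, map_smul, LinearMap.sum_apply, LinearMap.smul_apply]
      rw [← Finset.sum_add_distrib, Finset.smul_sum]
      refine Finset.sum_congr rfl fun i _ => ?_
      by_cases hi : y i = 0
      · simp [hi]
      rw [← smul_add, hs i (hpos i hi) i.is_lt, smul_comm]
    have hx : x = x ⟨0, hn⟩ • unitVec n 0 + y := by simp [hy]
    refine ⟨α * x ⟨0, hn⟩, ?_⟩
    generalize x ⟨0, hn⟩ = t at hx
    clear_value y
    subst hx
    calc μ (t • unitVec n 0 + y) (t • unitVec n 0 + y)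
        = t • t • μ (unitVec n 0) (unitVec n 0) +
            t • (μ (unitVec n 0) y + μ y (unitVec n 0)) + μ y y := by
          simp only [map_add, map_smul, LinearMap.add_apply, LinearMap.smul_apply, smul_add]
          abel
      _ = (α * t) • (t • unitVec n 0 + y) := by
          rw [hα, hey, hyy]
          module

end
end
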